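/- Fix an integer s ≥ 1. Let M be the free R-module on generators x0, x1_1, …, x1_s, y1_1, …, y1_s, x2, y2, and let d : M → M be the R-linear map with d(x0) = U·y1_1; d(x1_j) = U²·y1_j + U·y1_{j+1} for 1 ≤ j ≤ s−1; d(x1_s) = U²·y1_s; d(x2) = x1_s + U·y2; d(y2) = U·y1_s; and d(y1_j) = 0 for all j. Then d ∘ d = 0, the element z = U^{s−1}·x0 + Σ_{j=1}^{s−1} U^{s−1−j}·x1_j + y2 is a cycle, and the quotient of the homology H = ker d / im d by its U-torsion submodule is a free R-module of rank 1, generated by the image of the class of z. -/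

import Mathlib

noncomputable section

/-- `R = 𝔽₂[U]`, the polynomial ring in one variable over the field with two elements. -/
abbrev R : Type := Polynomial (ZMod 2)

/-- The variable `U` of `R = 𝔽₂[U]`. -/
def U : R := Polynomial.X

/-- The free `R`-module on the generators `x0, x2, y2` (indexed by `Fin 3`),
`x1_1, …, x1_s` (the first `Fin s` factor) and `y1_1, …, y1_s` (the second `Fin s`
factor). -/
abbrev M (s : ℕ) : Type := (Fin 3 ⊕ Fin s ⊕ Fin s) → R

def x0 (s : ℕ) : M s := Pi.single (Sum.inl 0) 1
def x2 (s : ℕ) : M s := Pi.single (Sum.inl 1) 1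
def y2 (s : ℕ) : M s := Pi.single (Sum.inl 2) 1
/-- `x1 s j` is the generator `x1_{j+1}` (so `j : Fin s` is the 0-based index). -/
def x1 (s : ℕ) (j : Fin s) : M s := Pi.single (Sum.inr (Sum.inl j)) 1
/-- `y1 s j` is the generator `y1_{j+1}` (so `j : Fin s` is the 0-based index). -/
def y1 (s : ℕ) (j : Fin s) : M s := Pi.single (Sum.inr (Sum.inr j)) 1

section Helpers

variable {s : ℕ}

lemma M.add_self_eq_zero (m : M s) : m + m = 0 :=
  funext fun i => CharTwo.add_self_eq_zero (m i)

/-- Two linear maps out of `M s` agree if they agree on the generators. -/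
lemma M.linearMap_ext {N : Type*} [AddCommMonoid N] [Module R N] {f g : M s →ₗ[R] N}
    (hx0 : f (x0 s) = g (x0 s)) (hx2 : f (x2 s) = g (x2 s)) (hy2 : f (y2 s) = g (y2 s))
    (hx1 : ∀ j, f (x1 s j) = g (x1 s j)) (hy1 : ∀ j, f (y1 s j) = g (y1 s j)) : f = g := by
  refine (Pi.basisFun R _).ext fun i => ?_
  rw [Pi.basisFun_apply]
  rcases i with i | j | j
  · fin_cases i
    exacts [hx0, hx2, hy2]
  · exact hx1 j
  · exact hy1 j

/-- The chain `U^n • x0 + ∑_{j<n} U^(n-1-j) • x1_{j+1}`, whose boundary is `U • y1_{n+1}`. -/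
def primitive (s n : ℕ) : M s :=
  U ^ n • x0 s + ∑ j : Fin s, if (j : ℕ) < n then U ^ (n - 1 - (j : ℕ)) • x1 s j else 0

lemma primitive_zero : primitive s 0 = x0 s := by
  simp [primitive]

lemma primitive_succ (n : ℕ) (hn : n < s) :
    primitive s (n + 1) = x1 s ⟨n, hn⟩ + U • primitive s n := by
  have hterm : ∀ j : Fin s,
      (if (j : ℕ) < n + 1 then U ^ (n + 1 - 1 - (j : ℕ)) • x1 s j else 0) =
        (if j = ⟨n, hn⟩ then x1 s j else 0) +
          U • (if (j : ℕ) < n then U ^ (n - 1 - (j : ℕ)) • x1 s j else 0) := by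
    intro j
    rcases lt_trichotomy (j : ℕ) n with h | h | h
    · have hexp : n - (j : ℕ) = (n - 1 - (j : ℕ)) + 1 := by omega
      rw [if_pos (by omega), if_neg (by simp [Fin.ext_iff, h.ne]), if_pos h, smul_smul,
        ← pow_succ', zero_add, Nat.add_sub_cancel, hexp]
    · have hj : j = ⟨n, hn⟩ := Fin.ext h
      subst hj
      simp
    · rw [if_neg (by omega), if_neg (by simp [Fin.ext_iff, h.ne']), if_neg (by omega)]
      simp
  unfold primitive
  rw [Finset.sum_congr rfl fun j _ => hterm j, Finset.sum_add_distrib, ← Finset.smul_sum,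
    Finset.sum_ite_eq' Finset.univ, if_pos (Finset.mem_univ _), pow_succ', mul_smul, smul_add]
  abel

/-- The contraction sending `y1_{j+1}` to `primitive s j`, `x1_s` to `U • x2`, and the other
generators to `0`. -/
def contraction (s : ℕ) : M s →ₗ[R] M s :=
  (Pi.basisFun R _).constr R (Sum.elim (fun _ => 0)
    (Sum.elim (fun j : Fin s => if (j : ℕ) + 1 < s then 0 else U • x2 s)
      fun j : Fin s => primitive s j))

lemma contraction_single (i : Fin 3 ⊕ Fin s ⊕ Fin s) :
    contraction s (Pi.single i 1) = Sum.elim (fun _ => 0)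
      (Sum.elim (fun j : Fin s => if (j : ℕ) + 1 < s then 0 else U • x2 s)
        fun j : Fin s => primitive s j) i := by
  rw [contraction, ← Pi.basisFun_apply, Module.Basis.constr_basis]

lemma contraction_x0 : contraction s (x0 s) = 0 := contraction_single _

lemma contraction_x2 : contraction s (x2 s) = 0 := contraction_single _

lemma contraction_y2 : contraction s (y2 s) = 0 := contraction_single _

lemma contraction_x1 (j : Fin s) :
    contraction s (x1 s j) = if (j : ℕ) + 1 < s then 0 else U • x2 s := contraction_single _

lemma contraction_y1 (j : Fin s) : contraction s (y1 s j) = primitive s j :=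
  contraction_single _

/-- The functional reading off the coefficient of `y2` plus `U` times that of `x1_s`. -/
def freePart (s : ℕ) (hs : 1 ≤ s) : M s →ₗ[R] R :=
  LinearMap.proj (Sum.inl 2) +
    U • LinearMap.proj (Sum.inr (Sum.inl ⟨s - 1, Nat.sub_lt hs Nat.one_pos⟩))

lemma freePart_x0 (hs : 1 ≤ s) : freePart s hs (x0 s) = 0 := by
  simp [freePart, x0]

lemma freePart_x2 (hs : 1 ≤ s) : freePart s hs (x2 s) = 0 := by
  simp [freePart, x2]

lemma freePart_y2 (hs : 1 ≤ s) : freePart s hs (y2 s) = 1 := by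
  simp [freePart, y2]

lemma freePart_y1 (hs : 1 ≤ s) (j : Fin s) : freePart s hs (y1 s j) = 0 := by
  simp [freePart, y1]

lemma freePart_x1_of_lt (hs : 1 ≤ s) (j : Fin s) (hj : (j : ℕ) + 1 < s) :
    freePart s hs (x1 s j) = 0 := by
  have hne : (⟨s - 1, Nat.sub_lt hs Nat.one_pos⟩ : Fin s) ≠ j := by
    simp only [ne_eq, Fin.ext_iff]
    omega
  simp [freePart, x1, hne]

lemma freePart_x1_last (hs : 1 ≤ s) :
    freePart s hs (x1 s ⟨s - 1, Nat.sub_lt hs Nat.one_pos⟩) = U := by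
  simp [freePart, x1]

lemma freePart_primitive (hs : 1 ≤ s) (n : ℕ) (hn : n < s) :
    freePart s hs (primitive s n) = 0 := by
  induction n with
  | zero => rw [primitive_zero, freePart_x0]
  | succ n ih =>
    rw [primitive_succ n (by omega), map_add, map_smul, ih (by omega),
      freePart_x1_of_lt hs _ hn, smul_zero, add_zero]

lemma eq_last_of_not_lt (hs : 1 ≤ s) (j : Fin s) (hj : ¬ (j : ℕ) + 1 < s) :
    j = ⟨s - 1, Nat.sub_lt hs Nat.one_pos⟩ :=
  Fin.ext (by have := j.isLt; simp only; omega)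

/-- If a functional `φ` kills boundaries, takes the value `1` on the cycle `z`,
and `u • (m - φ m • z)` is a boundary for every cycle `m`, then `z` freely generates the
quotient of the homology by its `u`-power torsion. -/
lemma bijective_toSpanSingleton_homology_mod_torsion {A N : Type*} [CommRing A] [IsDomain A]
    [AddCommGroup N] [Module A N] (d : N →ₗ[A] N) (u : A) (hu : u ≠ 0) (φ : N →ₗ[A] A)
    (hφ : ∀ m, φ (d m) = 0) (z : N) (hz : z ∈ LinearMap.ker d) (hφz : φ z = 1)
    (h : ∀ m ∈ LinearMap.ker d, u • (m - φ m • z) ∈ LinearMap.range d) :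
    Function.Bijective
      (LinearMap.toSpanSingleton A
        ((LinearMap.ker d ⧸ (LinearMap.range d).comap (LinearMap.ker d).subtype) ⧸
          Submodule.torsion' A
            (LinearMap.ker d ⧸ (LinearMap.range d).comap (LinearMap.ker d).subtype)
            (Submonoid.powers u))
        (Submodule.Quotient.mk (Submodule.Quotient.mk ⟨z, hz⟩))) := by
  constructor
  · rw [injective_iff_map_eq_zero]
    intro r hr
    rw [LinearMap.toSpanSingleton_apply, ← Submodule.Quotient.mk_smul,
      Submodule.Quotient.mk_eq_zero, Submodule.mem_torsion'_iff] at hr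
    obtain ⟨⟨v, hv⟩, hr⟩ := hr
    obtain ⟨n, rfl⟩ := Submonoid.mem_powers_iff v u |>.mp hv
    rw [Submonoid.mk_smul, ← Submodule.Quotient.mk_smul, ← Submodule.Quotient.mk_smul,
      Submodule.Quotient.mk_eq_zero] at hr
    obtain ⟨m, hm⟩ := hr
    have hval := congrArg φ hm
    simp only [hφ, Submodule.subtype_apply, map_smul, hφz, smul_eq_mul, mul_one] at hval
    exact (mul_eq_zero.mp hval.symm).resolve_left (pow_ne_zero n hu)
  · intro q
    obtain ⟨q, rfl⟩ := Submodule.Quotient.mk_surjective _ q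
    obtain ⟨m, rfl⟩ := Submodule.Quotient.mk_surjective _ q
    refine ⟨φ m, Eq.symm ?_⟩
    rw [LinearMap.toSpanSingleton_apply, ← Submodule.Quotient.mk_smul, Submodule.Quotient.eq,
      Submodule.mem_torsion'_iff]
    refine ⟨⟨u, Submonoid.mem_powers u⟩, ?_⟩
    rw [Submonoid.mk_smul, ← Submodule.Quotient.mk_smul, ← Submodule.Quotient.mk_sub,
      ← Submodule.Quotient.mk_smul, Submodule.Quotient.mk_eq_zero]
    exact h m m.2

end Helpers

/-- Fix `s ≥ 1`.  Let `M` be the free `R`-module on the generators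
`x0, x1_1, …, x1_s, y1_1, …, y1_s, x2, y2`, and let `d : M → M` be the `R`-linear map with
`d x0 = U • y1_1`; `d x1_j = U² • y1_j + U • y1_{j+1}` for `1 ≤ j ≤ s - 1`;
`d x1_s = U² • y1_s`; `d x2 = x1_s + U • y2`; `d y2 = U • y1_s`; and `d y1_j = 0` for all
`j`.  Then `d ∘ d = 0`, the element
`z = U^(s-1) • x0 + ∑_{j=1}^{s-1} U^(s-1-j) • x1_j + y2` is a cycle, and the quotient of
the homology `H = ker d / im d` by its `U`-torsion submodule is a free `R`-module of rank
one generated by the image of the class of `z`, i.e. the map `r ↦ r • [[z]]` from `R` to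
that quotient is bijective. -/
theorem homology_mod_torsion_free_rank_one (s : ℕ) (hs : 1 ≤ s) (d : M s →ₗ[R] M s)
    (hx0 : d (x0 s) = U • y1 s ⟨0, hs⟩)
    (hx1 : ∀ j : Fin s, ∀ h : (j : ℕ) + 1 < s,
      d (x1 s j) = (U ^ 2) • y1 s j + U • y1 s ⟨(j : ℕ) + 1, h⟩)
    (hx1s : d (x1 s ⟨s - 1, Nat.sub_lt hs Nat.one_pos⟩)
      = (U ^ 2) • y1 s ⟨s - 1, Nat.sub_lt hs Nat.one_pos⟩)
    (hx2 : d (x2 s) = x1 s ⟨s - 1, Nat.sub_lt hs Nat.one_pos⟩ + U • y2 s)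
    (hy2 : d (y2 s) = U • y1 s ⟨s - 1, Nat.sub_lt hs Nat.one_pos⟩)
    (hy1 : ∀ j : Fin s, d (y1 s j) = 0) :
    d ∘ₗ d = 0 ∧
    ∃ hz : (U ^ (s - 1)) • x0 s
        + (∑ j : Fin s, if (j : ℕ) + 1 < s then (U ^ (s - 2 - (j : ℕ))) • x1 s j else 0)
        + y2 s ∈ LinearMap.ker d,
      Function.Bijective
        (LinearMap.toSpanSingleton R
          ((LinearMap.ker d ⧸ (LinearMap.range d).comap (LinearMap.ker d).subtype) ⧸
            Submodule.torsion' R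
              (LinearMap.ker d ⧸ (LinearMap.range d).comap (LinearMap.ker d).subtype)
              (Submonoid.powers U))
          (Submodule.Quotient.mk (Submodule.Quotient.mk
            ⟨(U ^ (s - 1)) • x0 s
              + (∑ j : Fin s, if (j : ℕ) + 1 < s then (U ^ (s - 2 - (j : ℕ))) • x1 s j else 0)
              + y2 s, hz⟩))) := by
  have hprim : ∀ n (hn : n < s), d (primitive s n) = U • y1 s ⟨n, hn⟩ := by
    intro n
    induction n with
    | zero => intro hn; rw [primitive_zero, hx0]
    | succ n ih =>
      intro hn
      rw [primitive_succ n (by omega), map_add, map_smul, ih (by omega), hx1 _ hn, smul_smul,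
        ← pow_two, add_right_comm, M.add_self_eq_zero, zero_add]
  have hdd : d ∘ₗ d = 0 := by
    apply M.linearMap_ext
    · simp [hx0, hy1]
    · simp [hx2, hx1s, hy2, smul_smul, ← pow_two, M.add_self_eq_zero]
    · simp [hy2, hy1]
    · intro j
      by_cases hj : (j : ℕ) + 1 < s
      · simp [hx1 j hj, hy1]
      · simp [eq_last_of_not_lt hs j hj, hx1s, hy1]
    · simp [hy1]
  have hzeq : (U ^ (s - 1)) • x0 s
        + (∑ j : Fin s, if (j : ℕ) + 1 < s then (U ^ (s - 2 - (j : ℕ))) • x1 s j else 0)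
        + y2 s = primitive s (s - 1) + y2 s := by
    simp only [primitive, Nat.lt_sub_iff_add_lt, Nat.sub_sub, Nat.reduceAdd]
  have hz : primitive s (s - 1) + y2 s ∈ LinearMap.ker d := by
    rw [LinearMap.mem_ker, map_add, hprim _ (Nat.sub_lt hs Nat.one_pos), hy2,
      M.add_self_eq_zero]
  have hφz : freePart s hs (primitive s (s - 1) + y2 s) = 1 := by
    rw [map_add, freePart_primitive hs _ (Nat.sub_lt hs Nat.one_pos), freePart_y2, zero_add]
  have hφd : freePart s hs ∘ₗ d = 0 := by
    apply M.linearMap_ext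
    · simp [hx0, freePart_y1]
    · simp [hx2, freePart_x1_last, freePart_y2, CharTwo.add_self_eq_zero]
    · simp [hy2, freePart_y1]
    · intro j
      by_cases hj : (j : ℕ) + 1 < s
      · simp [hx1 j hj, freePart_y1]
      · simp [eq_last_of_not_lt hs j hj, hx1s, freePart_y1]
    · simp [hy1]
  have hhomotopy : d ∘ₗ contraction s + contraction s ∘ₗ d
      + U • (freePart s hs).smulRight (primitive s (s - 1) + y2 s) = U • LinearMap.id := by
    apply M.linearMap_ext
    · simp [contraction_x0, hx0, contraction_y1, primitive_zero, freePart_x0]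
    · simp [contraction_x2, hx2, contraction_y2, contraction_x1, freePart_x2,
        Nat.sub_add_cancel hs]
    · simp only [LinearMap.add_apply, LinearMap.comp_apply, LinearMap.smul_apply,
        LinearMap.smulRight_apply, LinearMap.id_apply, contraction_y2, hy2, map_zero, map_smul,
        contraction_y1, freePart_y2, one_smul, smul_add, zero_add]
      rw [← add_assoc, M.add_self_eq_zero, zero_add]
    · intro j
      by_cases hj : (j : ℕ) + 1 < s
      · simp only [LinearMap.add_apply, LinearMap.comp_apply, LinearMap.smul_apply,
          LinearMap.smulRight_apply, LinearMap.id_apply, contraction_x1, if_pos hj, hx1 j hj,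
          map_zero, map_add, map_smul, contraction_y1, freePart_x1_of_lt hs j hj, zero_smul,
          smul_zero, add_zero, zero_add, primitive_succ _ j.isLt, smul_add, smul_smul, ← pow_two]
        rw [add_left_comm, M.add_self_eq_zero, add_zero]
      · rw [eq_last_of_not_lt hs j hj]
        simp only [LinearMap.add_apply, LinearMap.comp_apply, LinearMap.smul_apply,
          LinearMap.smulRight_apply, LinearMap.id_apply, contraction_x1, Nat.sub_add_cancel hs,
          lt_irrefl, if_false, map_smul, hx1s, hx2, contraction_y1, freePart_x1_last, smul_add,
          smul_smul, ← pow_two]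
        rw [add_assoc, add_assoc, ← add_assoc (U ^ 2 • primitive s (s - 1)),
          M.add_self_eq_zero, zero_add, M.add_self_eq_zero, add_zero]
    · intro j
      simp [contraction_y1, hprim _ j.isLt, hy1, freePart_y1]
  refine ⟨hdd, ?_⟩
  simp only [hzeq]
  refine ⟨hz, bijective_toSpanSingleton_homology_mod_torsion d U Polynomial.X_ne_zero
    (freePart s hs) (LinearMap.congr_fun hφd) _ hz hφz fun m hm => ⟨contraction s m, ?_⟩⟩
  have hm' := LinearMap.congr_fun hhomotopy m
  simp only [LinearMap.add_apply, LinearMap.comp_apply, LinearMap.smul_apply,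
    LinearMap.smulRight_apply, LinearMap.id_apply, LinearMap.mem_ker.mp hm, map_zero,
    add_zero] at hm'
  rw [smul_sub, ← hm', add_sub_cancel_right]
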